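/- Let A be an algebra over a field k. A perfect complex E of left A-modules is compactly supported in D(A-Mod) if and only if every cohomology module H^i(E) is finite-dimensional over k. In other words, the full subcategory of compactly supported compact objects of D(A-Mod) equals the full subcategory of perfect complexes whose cohomology modules are finite-dimensional. -/

import Mathlib

open CategoryTheory CategoryTheory.Limits DerivedCategory

noncomputable section

universe w

/-- Transport of a scalar action `k →+* End M` along an additive functor `T`. -/
def transportEnd {k : Type} [CommRing k] {D : Type*} [Category D] {D' : Type*} [Category D']
    [Preadditive D] [Preadditive D'] (T : D ⥤ D') [T.Additive] {M : D}
    (φ : k →+* End M) : k →+* End (T.obj M) :=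
  (RingHom.mk' (Functor.mapEnd M T) (fun _ _ => T.map_add)).comp φ

/-- The `k`-module structure on `Hom(F, G)` induced by a ring morphism `k →+* End G`
(acting by postcomposition). -/
def homModule {k : Type} [CommRing k] {D : Type*} [Category D] [Preadditive D]
    {G : D} (φ : k →+* End G) (F : D) : Module k (F ⟶ G) :=
  Module.compHom (F ⟶ G) φ

/-- The dimension (as a cardinal) of `Hom(F, G)` over `k`, where the `k`-vector space
structure is induced by the ring morphism `φ : k →+* End G`. -/
def homRank (k : Type) [Field k] {D : Type*} [Category D] [Preadditive D]
    {G : D} (φ : k →+* End G) (F : D) : Cardinal :=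
  letI := homModule φ F
  Module.rank k (F ⟶ G)

/-- A complex is bounded if all but finitely many of its terms are zero objects. -/
def IsBoundedComplex {C : Type*} [Category C] [Limits.HasZeroMorphisms C]
    (E : CochainComplex C ℤ) : Prop :=
  ∃ a b : ℤ, ∀ i : ℤ, (i < a ∨ b < i) → IsZero (E.X i)

variable (k A : Type) [Field k] [Ring A] [Algebra k A]
variable [HasDerivedCategory.{w} (ModuleCat A)]

/-- The canonical action of `k` on the object of the derived category of `A`-modules
determined by a complex `E`, shifted by `i`: `c : k` acts as the image under the
localization functor and the shift functor of the endomorphism `c • 𝟙 E` of `E`. -/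
def shiftedScalarAction (E : CochainComplex (ModuleCat A) ℤ) (i : ℤ) :
    k →+* End ((shiftFunctor (DerivedCategory (ModuleCat A)) i).obj (Q.obj E)) :=
  transportEnd (shiftFunctor (DerivedCategory (ModuleCat A)) i)
    (transportEnd Q (algebraMap k (End E)))

/-- A complex of `A`-modules is perfect if it is quasi-isomorphic (i.e. isomorphic in the
derived category) to a bounded complex of finitely generated projective modules. -/
def IsPerfectComplex (F : CochainComplex (ModuleCat A) ℤ) : Prop :=
  ∃ P : CochainComplex (ModuleCat A) ℤ, IsBoundedComplex P ∧
    (∀ n : ℤ, Module.Finite A (P.X n) ∧ Module.Projective A (P.X n)) ∧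
    Nonempty (Q.obj P ≅ Q.obj F)

/-- The canonical comparison map `⨁ i, Hom(E, f i) →+ Hom(E, ∐ f)`. -/
def coproductComparison {D : Type*} [Category D] [Preadditive D] (E : D)
    {ι : Type} (f : ι → D) [HasCoproduct f] :
    DirectSum ι (fun i : ι => E ⟶ f i) →+ (E ⟶ ∐ f) :=
  letI := Classical.decEq ι
  DirectSum.toAddMonoid (fun i => Preadditive.rightComp E (Sigma.ι f i))

/-- An object `E` is compact if `Hom(E, -)` commutes with small coproducts. -/
def IsCompactObject {D : Type*} [Category D] [Preadditive D] (E : D) : Prop :=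
  ∀ (ι : Type) (f : ι → D), ∀ (_ : HasCoproduct f),
    Function.Bijective (coproductComparison E f)

universe v

section
variable {R : Type} [Ring R]
open HomologicalComplex

abbrev Cx.{v1} (R : Type) [Ring R] := CochainComplex (ModuleCat.{v1} R) ℤ

abbrev RR (R : Type) [Ring R] : ModuleCat.{v} R := ModuleCat.of R (ULift.{v} R)

def tsp {M : ModuleCat.{v} R} (x : M) : RR R ⟶ M :=
  ModuleCat.ofHom ((LinearMap.toSpanSingleton R M x).comp ULift.moduleEquiv.toLinearMap)

lemma tsp_one {M : ModuleCat.{v} R} (x : M) : (tsp x).hom (ULift.up.{v} (1 : R)) = x :=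
  one_smul R x

lemma RR_ext {M : ModuleCat.{v} R} {f g : RR R ⟶ M}
    (h : f.hom (ULift.up.{v} (1 : R)) = g.hom (ULift.up.{v} (1 : R))) : f = g := by
  ext x
  have hx : x = x.down • (ULift.up.{v} (1 : R)) := by
    ext; simp
  rw [hx, map_smul, map_smul, h]

abbrev Zc (K : Cx.{v} R) (n : ℤ) : Submodule R (K.X n) := LinearMap.ker (K.d n (n+1)).hom

def clHom (K : Cx.{v} R) (n : ℤ) : ModuleCat.of R (Zc K n) ⟶ K.homology n :=
  K.liftCycles (ModuleCat.ofHom (Zc K n).subtype) (n+1) (by simp) (by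
    ext x; exact x.2) ≫ K.homologyπ n

def cl (K : Cx.{v} R) (n : ℤ) : Zc K n →ₗ[R] K.homology n := (clHom K n).hom

def Zmap {K L : Cx.{v} R} (φ : K ⟶ L) (n : ℤ) : Zc K n →ₗ[R] Zc L n :=
  (φ.f n).hom.restrict (fun x hx => by
    have := φ.comm n (n+1)
    have h2 := congr($(this).hom x)
    simp only [ModuleCat.hom_comp, LinearMap.comp_apply] at h2
    change (L.d n (n+1)).hom ((φ.f n).hom x) = 0
    rw [h2]
    have : (K.d n (n+1)).hom x = 0 := hx
    rw [this, map_zero])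

lemma Zmap_val {K L : Cx.{v} R} (φ : K ⟶ L) (n : ℤ) (x : Zc K n) :
    (Zmap φ n x : L.X n) = (φ.f n).hom x := rfl

lemma cl_map {K L : Cx.{v} R} (φ : K ⟶ L) (n : ℤ) (x : Zc K n) :
    (homologyMap φ n).hom (cl K n x) = cl L n (Zmap φ n x) := by
  have : clHom K n ≫ homologyMap φ n = ModuleCat.ofHom (Zmap φ n) ≫ clHom L n := by
    simp only [clHom, Category.assoc, homologyπ_naturality]
    rw [← Category.assoc, ← Category.assoc]
    congr 1
    rw [← cancel_mono (L.iCycles n)]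
    simp
    rfl
  exact congr($(this).hom x)

lemma cl_surj (K : Cx.{v} R) (n : ℤ) : Function.Surjective (cl K n) := by
  intro h
  obtain ⟨z, rfl⟩ := (ModuleCat.epi_iff_surjective (K.homologyπ n)).1 inferInstance h
  have hz : (K.d n (n+1)).hom ((K.iCycles n).hom z) = 0 := by
    have : K.iCycles n ≫ K.d n (n+1) = 0 := by simp
    exact congr($(this).hom z)
  refine ⟨⟨(K.iCycles n).hom z, hz⟩, ?_⟩
  have : (K.liftCycles (ModuleCat.ofHom (Zc K n).subtype) (n+1) (by simp) (by
    ext x; exact x.2)).hom ⟨(K.iCycles n).hom z, hz⟩ = z := by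
    apply (ModuleCat.mono_iff_injective (K.iCycles n)).1 inferInstance
    have := K.liftCycles_i (ModuleCat.ofHom (Zc K n).subtype) (i := n) (n+1) (by simp) (by
      ext x; exact x.2)
    exact congr($(this).hom ⟨(K.iCycles n).hom z, hz⟩)
  exact congrArg (K.homologyπ n).hom this

lemma cl_eq_zero_iff (K : Cx.{v} R) (n m : ℤ) (hm : m + 1 = n) (x : Zc K n) :
    cl K n x = 0 ↔ ∃ y : K.X m, (K.d m n).hom y = x := by
  have hex : (ShortComplex.mk (K.toCycles m n) (K.homologyπ n) (by simp)).Exact :=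
    ShortComplex.exact_of_g_is_cokernel _ (K.homologyIsCokernel m n (by simp; omega))
  rw [ShortComplex.moduleCat_exact_iff] at hex
  have hi : (K.iCycles n).hom ((K.liftCycles (ModuleCat.ofHom (Zc K n).subtype) (n+1) (by simp) (by
    ext x; exact x.2)).hom x) = x := by
    have := K.liftCycles_i (ModuleCat.ofHom (Zc K n).subtype) (i := n) (n+1) (by simp) (by
      ext x; exact x.2)
    exact congr($(this).hom x)
  constructor
  · intro h
    obtain ⟨y, hy⟩ := hex _ h
    refine ⟨y, ?_⟩
    rw [← hi]
    erw [← hy]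
    exact congr($((K.toCycles_i m n)).hom y).symm
  · rintro ⟨y, hy⟩
    have : ((K.liftCycles (ModuleCat.ofHom (Zc K n).subtype) (n+1) (by simp) (by
      ext x; exact x.2)).hom x) = (K.toCycles m n).hom y := by
      apply (ModuleCat.mono_iff_injective (K.iCycles n)).1 inferInstance
      refine hi.trans (hy.symm.trans ?_)
      exact congr($((K.toCycles_i m n)).hom y).symm
    refine (congrArg (K.homologyπ n).hom this).trans ?_
    exact congr($((K.toCycles_comp_homologyπ m n)).hom y)
end
section
variable {R : Type} [Ring R]
open HomologicalComplex

lemma quasiIso_of_bij {K L : Cx.{v} R} (φ : K ⟶ L)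
    (h : ∀ n, Function.Bijective (homologyMap φ n).hom) : QuasiIso φ where
  quasiIsoAt n := by
    rw [quasiIsoAt_iff_isIso_homologyMap]
    exact (ConcreteCategory.isIso_iff_bijective (homologyMap φ n)).2 (h n)

lemma bij_of_quasiIso {K L : Cx.{v} R} (φ : K ⟶ L) [QuasiIso φ] (n : ℤ) :
    Function.Bijective (homologyMap φ n).hom :=
  (ConcreteCategory.isIso_iff_bijective (homologyMap φ n)).1 inferInstance

lemma hMap_comp {K L M : Cx.{v} R} (φ : K ⟶ L) (ψ : L ⟶ M) (n : ℤ) (x : K.homology n) :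
    (homologyMap (φ ≫ ψ) n).hom x = (homologyMap ψ n).hom ((homologyMap φ n).hom x) := by
  rw [homologyMap_comp]; rfl

lemma iso_inv_hom {M N : ModuleCat.{v} R} (e : M ≅ N) (x : N) : e.hom.hom (e.inv.hom x) = x :=
  congr($(e.inv_hom_id).hom x)

lemma iso_hom_inv {M N : ModuleCat.{v} R} (e : M ≅ N) (x : M) : e.inv.hom (e.hom.hom x) = x :=
  congr($(e.hom_inv_id).hom x)

variable {B : Type} (X : B → Cx.{v} R)

lemma gen_X (n : ℤ) (x : (∐ X).X n) :
    ∃ (s : Finset B) (y : ∀ b, (X b).X n), x = ∑ b ∈ s, ((Sigma.ι X b).f n).hom (y b) := by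
  let S : Submodule R ((∐ X).X n) := ⨆ b, LinearMap.range ((Sigma.ι X b).f n).hom
  have hS : x ∈ S := by
    have h0 : ModuleCat.ofHom S.mkQ = 0 := by
      have hc := isColimitOfPreserves (HomologicalComplex.eval (ModuleCat.{v} R) (ComplexShape.up ℤ) n)
        (coproductIsCoproduct X)
      refine hc.hom_ext ?_
      rintro ⟨b⟩
      ext z
      change S.mkQ (((Sigma.ι X b).f n).hom z) = 0
      rw [Submodule.mkQ_apply, Submodule.Quotient.mk_eq_zero]
      exact Submodule.mem_iSup_of_mem b ⟨z, rfl⟩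
    have : S.mkQ x = 0 := congr($(h0).hom x)
    rwa [Submodule.mkQ_apply, Submodule.Quotient.mk_eq_zero] at this
  obtain ⟨f, hf, hx⟩ := (Submodule.mem_iSup_iff_exists_finsupp _ _).1 hS
  choose y hy using hf
  refine ⟨f.support, y, ?_⟩
  rw [← hx, Finsupp.sum]
  exact Finset.sum_congr rfl (fun b _ => (hy b).symm)

open Classical in
def sproj (b : B) : ∐ X ⟶ X b :=
  Sigma.desc (fun b' => if h : b' = b then eqToHom (by rw [h]) else 0)

@[simp]
lemma ι_sproj_self (b : B) : Sigma.ι X b ≫ sproj X b = 𝟙 _ := by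
  simp [sproj]

lemma ι_sproj_ne (b b' : B) (h : b' ≠ b) : Sigma.ι X b' ≫ sproj X b = 0 := by
  simp [sproj, h]

lemma sproj_sum_X (n : ℤ) (s : Finset B) (y : ∀ b, (X b).X n) (b : B) (hb : b ∈ s) :
    ((sproj X b).f n).hom (∑ b ∈ s, ((Sigma.ι X b).f n).hom (y b)) = y b := by
  rw [map_sum, Finset.sum_eq_single b]
  · have := congr(($(ι_sproj_self X b)).f n)
    exact congr($(this).hom (y b))
  · intro b' _ h
    have := congr(($(ι_sproj_ne X b b' h)).f n)
    exact congr($(this).hom (y b'))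
  · intro h; exact absurd hb h

lemma sproj_sum_H (n : ℤ) (s : Finset B) (y : ∀ b, (X b).homology n) (b : B) (hb : b ∈ s) :
    (homologyMap (sproj X b) n).hom (∑ b ∈ s, (homologyMap (Sigma.ι X b) n).hom (y b)) = y b := by
  rw [map_sum, Finset.sum_eq_single b]
  · rw [← hMap_comp, ι_sproj_self]; simp
  · intro b' _ h
    rw [← hMap_comp, ι_sproj_ne X b b' h]; simp
  · intro h; exact absurd hb h

lemma gen_H (n : ℤ) (h : (∐ X).homology n) :
    ∃ (s : Finset B) (y : ∀ b, (X b).homology n),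
      h = ∑ b ∈ s, (homologyMap (Sigma.ι X b) n).hom (y b) := by
  classical
  obtain ⟨⟨x, hx⟩, rfl⟩ := cl_surj _ _ h
  obtain ⟨s, y, rfl⟩ := gen_X X n x
  have hy : ∀ b ∈ s, y b ∈ Zc (X b) n := by
    intro b hb
    have := (Zmap (sproj X b) n ⟨_, hx⟩).2
    rw [Zmap_val] at this
    simpa only [sproj_sum_X X n s y b hb] using this
  let y' : ∀ b, Zc (X b) n := fun b => if hb : b ∈ s then ⟨y b, hy b hb⟩ else 0
  refine ⟨s, fun b => cl _ n (y' b), ?_⟩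
  simp only [cl_map]
  rw [← map_sum]
  congr 1
  ext
  rw [Submodule.coe_sum]
  refine Finset.sum_congr rfl (fun b hb => ?_)
  simp [y', hb, Zmap_val]

lemma quasiIso_sigmaMap {X Y : B → Cx.{v} R} (s : ∀ b, X b ⟶ Y b) [∀ b, QuasiIso (s b)] :
    QuasiIso (Limits.Sigma.map s) := by
  have key : ∀ n b (x : (X b).homology n), (homologyMap (Limits.Sigma.map s) n).hom
      ((homologyMap (Sigma.ι X b) n).hom x) = (homologyMap (Sigma.ι Y b) n).hom
      ((homologyMap (s b) n).hom x) := by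
    intro n b x
    rw [← hMap_comp, ← hMap_comp, Sigma.ι_map]
  apply quasiIso_of_bij
  intro n
  constructor
  · rw [injective_iff_map_eq_zero]
    intro h h0
    obtain ⟨t, y, rfl⟩ := gen_H X n h
    refine Finset.sum_eq_zero (fun b hb => ?_)
    rw [map_sum] at h0
    simp only [key] at h0
    have := sproj_sum_H Y n t (fun b => (homologyMap (s b) n).hom (y b)) b hb
    rw [h0, map_zero] at this
    have h1 : y b = 0 := (bij_of_quasiIso (s b) n).1 (by rw [← this, map_zero])
    rw [h1, map_zero]
  · intro h
    obtain ⟨t, y, rfl⟩ := gen_H Y n h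
    choose z hz using fun b => (bij_of_quasiIso (s b) n).2 (y b)
    refine ⟨∑ b ∈ t, (homologyMap (Sigma.ι X b) n).hom (z b), ?_⟩
    rw [map_sum]
    refine Finset.sum_congr rfl (fun b hb => ?_)
    rw [key, hz]

lemma pi_X_ext (n : ℤ) (x y : (∏ᶜ X).X n)
    (h : ∀ b, ((Pi.π X b).f n).hom x = ((Pi.π X b).f n).hom y) : x = y := by
  have hc := isLimitOfPreserves (HomologicalComplex.eval (ModuleCat.{v} R) (ComplexShape.up ℤ) n)
        (productIsProduct X)
  have := hc.hom_ext (W := RR R) (f := tsp x)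
    (f' := tsp y) (by
      rintro ⟨b⟩
      apply RR_ext
      change ((Pi.π X b).f n).hom ((tsp x).hom _) = ((Pi.π X b).f n).hom ((tsp y).hom _)
      rw [tsp_one, tsp_one, h])
  have h2 := congr($(this).hom (ULift.up.{v} (1 : R)))
  exact (tsp_one x).symm.trans (h2.trans (tsp_one y))

lemma pi_X_lift (n : ℤ) (x : ∀ b, (X b).X n) :
    ∃ z : (∏ᶜ X).X n, ∀ b, ((Pi.π X b).f n).hom z = x b := by
  have hc := isLimitOfPreserves (HomologicalComplex.eval (ModuleCat.{v} R) (ComplexShape.up ℤ) n)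
        (productIsProduct X)
  let c : Cone (Discrete.functor X ⋙ HomologicalComplex.eval (ModuleCat.{v} R) (ComplexShape.up ℤ) n) :=
    { pt := RR R
      π := Discrete.natTrans (fun b => tsp (x b.as)) }
  refine ⟨(hc.lift c).hom (ULift.up.{v} (1 : R)), fun b => ?_⟩
  refine (congr($(hc.fac c ⟨b⟩).hom (ULift.up.{v} (1 : R)))).trans ?_
  exact tsp_one (x b)

lemma pi_H_ext (n : ℤ) (x : (∏ᶜ X).homology n)
    (h : ∀ b, (homologyMap (Pi.π X b) n).hom x = 0) : x = 0 := by
  obtain ⟨x, rfl⟩ := cl_surj _ _ x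
  simp only [cl_map, cl_eq_zero_iff _ n (n-1) (by omega)] at h ⊢
  choose y hy using h
  obtain ⟨z, hz⟩ := pi_X_lift X (n-1) y
  refine ⟨z, pi_X_ext X n _ _ (fun b => ?_)⟩
  rw [← Zmap_val, ← hy, ← hz]
  exact congr($((Pi.π X b).comm (n-1) n).hom z).symm

lemma pi_H_lift (n : ℤ) (x : ∀ b, (X b).homology n) :
    ∃ z : (∏ᶜ X).homology n, ∀ b, (homologyMap (Pi.π X b) n).hom z = x b := by
  choose y hy using fun b => cl_surj _ _ (x b)
  obtain ⟨z, hz⟩ := pi_X_lift X n (fun b => (y b).1)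
  have hz0 : z ∈ Zc (∏ᶜ X) n := by
    rw [LinearMap.mem_ker]
    refine pi_X_ext X (n+1) _ _ (fun b => ?_)
    have := congr($((Pi.π X b).comm n (n+1)).hom z).symm
    refine this.trans ?_
    rw [map_zero]
    refine (congrArg ((X b).d n (n+1)).hom (hz b)).trans (y b).2
  refine ⟨cl _ n ⟨z, hz0⟩, fun b => ?_⟩
  rw [cl_map, ← hy]
  congr 1
  ext
  exact hz b

lemma quasiIso_piMap {X Y : B → Cx.{v} R} (s : ∀ b, X b ⟶ Y b) [∀ b, QuasiIso (s b)] :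
    QuasiIso (Limits.Pi.map s) := by
  have key : ∀ n b (x : (∏ᶜ X).homology n), (homologyMap (Pi.π Y b) n).hom
      ((homologyMap (Limits.Pi.map s) n).hom x) = (homologyMap (s b) n).hom
      ((homologyMap (Pi.π X b) n).hom x) := by
    intro n b x
    rw [← hMap_comp, ← hMap_comp, Pi.map_π]
  apply quasiIso_of_bij
  intro n
  constructor
  · rw [injective_iff_map_eq_zero]
    intro h h0
    refine pi_H_ext X n _ (fun b => (bij_of_quasiIso (s b) n).1 ?_)
    rw [← key, h0, map_zero, map_zero]
  · intro h
    choose z hz using fun b => (bij_of_quasiIso (s b) n).2 ((homologyMap (Pi.π Y b) n).hom h)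
    obtain ⟨z, hz'⟩ := pi_H_lift X n z
    refine ⟨z, ?_⟩
    rw [← sub_eq_zero]
    refine pi_H_ext Y n _ (fun b => ?_)
    rw [map_sub, key, hz', hz, sub_self]
end
section
variable {R : Type} [Ring R] [HasDerivedCategory.{w} (ModuleCat.{v} R)]
open HomologicalComplex

abbrev HD (R : Type) [Ring R] [HasDerivedCategory.{w} (ModuleCat.{v} R)] (n : ℤ) :
    DerivedCategory (ModuleCat.{v} R) ⥤ ModuleCat.{v} R :=
  DerivedCategory.homologyFunctor (ModuleCat.{v} R) n

def fac (K : Cx.{v} R) (n : ℤ) : (HD R n).obj (Q.obj K) ≅ K.homology n :=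
  (homologyFunctorFactors (ModuleCat.{v} R) n).app K

lemma fac_hom_nat {K L : Cx.{v} R} (φ : K ⟶ L) (n : ℤ) (x) :
    (fac L n).hom.hom (((HD R n).map (Q.map φ)).hom x) =
      (homologyMap φ n).hom ((fac K n).hom.hom x) :=
  congr($((homologyFunctorFactors (ModuleCat.{v} R) n).hom.naturality φ).hom x)

lemma fac_inv_nat {K L : Cx.{v} R} (φ : K ⟶ L) (n : ℤ) (x) :
    ((HD R n).map (Q.map φ)).hom ((fac K n).inv.hom x) =
      (fac L n).inv.hom ((homologyMap φ n).hom x) :=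
  congr($((homologyFunctorFactors (ModuleCat.{v} R) n).inv.naturality φ).hom x).symm

lemma HD_comp {X Y Z : DerivedCategory (ModuleCat.{v} R)} (f : X ⟶ Y) (g : Y ⟶ Z) (n : ℤ) (x) :
    ((HD R n).map (f ≫ g)).hom x = ((HD R n).map g).hom (((HD R n).map f).hom x) := by
  rw [Functor.map_comp]; rfl

variable {B : Type}

lemma genQ (X : B → Cx.{v} R) (n : ℤ) (h : (HD R n).obj (Q.obj (∐ X))) :
    ∃ (s : Finset B) (y : ∀ b, (HD R n).obj (Q.obj (X b))),
      h = ∑ b ∈ s, ((HD R n).map (Q.map (Sigma.ι X b))).hom (y b) := by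
  obtain ⟨s, y, hy⟩ := gen_H X n ((fac _ n).hom.hom h)
  refine ⟨s, fun b => (fac _ n).inv.hom (y b), ?_⟩
  rw [← iso_hom_inv (fac _ n) h, hy, map_sum]
  exact Finset.sum_congr rfl (fun b _ => (fac_inv_nat _ _ _).symm)

lemma descQ (X : B → Cx.{v} R) {Y : DerivedCategory (ModuleCat.{v} R)}
    (g : ∀ b, Q.obj (X b) ⟶ Y) :
    ∃ f : Q.obj (∐ X) ⟶ Y, ∀ b, Q.map (Sigma.ι X b) ≫ f = g b := by
  let e := Q.objObjPreimageIso Y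
  choose X' s hs t ht using fun b => right_fac (g b ≫ e.inv)
  have : ∀ b, QuasiIso (s b) := fun b => (isIso_Q_map_iff_quasiIso _ _).1 (hs b)
  have := quasiIso_sigmaMap s
  refine ⟨inv (Q.map (Limits.Sigma.map s)) ≫ Q.map (Sigma.desc t) ≫ e.hom, fun b => ?_⟩
  have h1 : Q.map (Sigma.ι X b) = inv (Q.map (s b)) ≫ Q.map (Sigma.ι X' b) ≫
      Q.map (Limits.Sigma.map s) := by
    rw [← Q.map_comp, Sigma.ι_map, Q.map_comp, IsIso.inv_hom_id_assoc]
  rw [h1]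
  simp only [Category.assoc, IsIso.hom_inv_id_assoc]
  rw [← Q.map_comp_assoc, Sigma.ι_desc, ← Category.assoc, ← ht]
  simp

lemma iso_of_ι (X : B → Cx.{v} R) (z : Q.obj (∐ X) ⟶ Q.obj (∐ X))
    (hz : ∀ b, Q.map (Sigma.ι X b) ≫ z = Q.map (Sigma.ι X b)) : IsIso z := by
  rw [DerivedCategory.isIso_iff]
  intro n
  have : (HD R n).map z = 𝟙 _ := by
    ext h
    obtain ⟨s, y, rfl⟩ := genQ X n h
    rw [map_sum]
    refine Finset.sum_congr rfl (fun b _ => ?_)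
    rw [← HD_comp, hz]
  change IsIso ((HD R n).map z)
  rw [this]
  infer_instance

lemma uniqQ (X : B → Cx.{v} R) {Y : DerivedCategory (ModuleCat.{v} R)} (f : Q.obj (∐ X) ⟶ Y)
    (h : ∀ b, Q.map (Sigma.ι X b) ≫ f = 0) : f = 0 := by
  obtain ⟨Z, u, v, hT⟩ := Pretriangulated.distinguished_cocone_triangle₁ f
  have hex : ∀ b, ∃ z : Q.obj (X b) ⟶ Z, Q.map (Sigma.ι X b) = z ≫ u :=
    fun b => Pretriangulated.Triangle.coyoneda_exact₂ _ hT _ (h b)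
  choose z hz using hex
  obtain ⟨w, hw⟩ := descQ X z
  have : IsIso (w ≫ u) := iso_of_ι X _ (fun b => by
    rw [← Category.assoc, hw]; exact (hz b).symm)
  have huf : u ≫ f = 0 := Pretriangulated.comp_distTriang_mor_zero₁₂ _ hT
  rw [← cancel_epi (w ≫ u), Category.assoc, huf]
  simp

instance hasCoprodQ (X : B → Cx.{v} R) : HasCoproduct (fun b => (Q.obj (X b) : DerivedCategory (ModuleCat.{v} R))) := by
  refine ⟨⟨⟨Cofan.mk (Q.obj (∐ X)) (fun b => Q.map (Sigma.ι X b)), ?_⟩⟩⟩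
  refine Cofan.IsColimit.mk _ (fun s => (descQ X s.inj).choose)
    (fun s b => (descQ X s.inj).choose_spec b) (fun s m hm => ?_)
  rw [← sub_eq_zero]
  refine uniqQ X _ (fun b => ?_)
  rw [Preadditive.comp_sub, (descQ X s.inj).choose_spec b]
  exact sub_eq_zero.2 (hm b)

lemma comparison_sum {D : Type*} [Category D] [Preadditive D] (E : D)
    {ι : Type} (f : ι → D) [HasCoproduct f] (t) :
    ∃ (s : Finset ι) (y : ∀ i, E ⟶ f i),
      coproductComparison E f t = ∑ i ∈ s, y i ≫ Sigma.ι f i := by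
  classical
  refine ⟨DFinsupp.support t, t, ?_⟩
  conv_lhs => rw [← DirectSum.sum_support_of t]
  rw [map_sum]
  refine Finset.sum_congr rfl (fun i _ => ?_)
  unfold coproductComparison
  convert DirectSum.toAddMonoid_of (fun i => Preadditive.rightComp E (Sigma.ι f i)) i (t i)
  rfl

lemma comparison_of {D : Type*} [Category D] [Preadditive D] (E : D)
    {ι : Type} [DecidableEq ι] (f : ι → D) [HasCoproduct f] (i : ι) (y : E ⟶ f i) :
      coproductComparison E f (DirectSum.of (fun i => E ⟶ f i) i y) = y ≫ Sigma.ι f i := by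
  unfold coproductComparison
  convert DirectSum.toAddMonoid_of (fun i => Preadditive.rightComp E (Sigma.ι f i)) i y
  rfl

lemma comparison_inj {D : Type*} [Category D] [Preadditive D] (E : D)
    {ι : Type} (f : ι → D) [HasCoproduct f] : Function.Injective (coproductComparison E f) := by
  classical
  rw [injective_iff_map_eq_zero]
  intro t ht
  have hs := DirectSum.sum_support_of t
  rw [← hs, map_sum] at ht
  simp only [comparison_of] at ht
  ext i
  by_contra hi
  have hi' : i ∈ DFinsupp.support t := by simpa using hi
  have := congr($ht ≫ Sigma.π f i)
  rw [Preadditive.sum_comp, Finset.sum_eq_single i, Category.assoc, Sigma.ι_π_eq_id] at this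
  · apply hi; simpa using this
  · intro j _ hj
    rw [Category.assoc, Sigma.ι_π_of_ne f hj, comp_zero]
  · intro h; exact absurd hi' h

lemma main_lift {F : DerivedCategory (ModuleCat.{v} R)} (hF : IsCompactObject F)
    {N : Type} (X : B → Cx.{v} R) (Y : N → Cx.{v} R) (m : ∀ b n, X b ⟶ Y n)
    (hΦ : QuasiIso (Sigma.desc fun b => Pi.lift (m b)))
    (x : ∀ n, F ⟶ Q.obj (Y n)) :
    ∃ (s : Finset B) (y : ∀ b, F ⟶ Q.obj (X b)),
      ∀ n, x n = ∑ b ∈ s, y b ≫ Q.map (m b n) := by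
  -- weak product property
  obtain ⟨x', hx'⟩ : ∃ x' : F ⟶ Q.obj (∏ᶜ Y), ∀ n, x' ≫ Q.map (Pi.π Y n) = x n := by
    let e := Q.objObjPreimageIso F
    choose Y' g s hs ht using fun n => left_fac (e.hom ≫ x n)
    have : ∀ b, QuasiIso (s b) := fun b => (isIso_Q_map_iff_quasiIso _ _).1 (hs b)
    have := quasiIso_piMap s
    refine ⟨e.inv ≫ Q.map (Pi.lift g) ≫ inv (Q.map (Limits.Pi.map s)), fun n => ?_⟩
    have h1 : Q.map (Pi.π Y n) = Q.map (Limits.Pi.map s) ≫ Q.map (Pi.π Y' n) ≫ inv (Q.map (s n)) := by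
      rw [← Q.map_comp_assoc, Pi.map_π, Q.map_comp, Category.assoc, IsIso.hom_inv_id,
        Category.comp_id]
    rw [h1]
    simp only [Category.assoc, IsIso.inv_hom_id_assoc]
    rw [← Q.map_comp_assoc, Pi.lift_π, ← ht]
    simp
  set Φ := Sigma.desc fun b => Pi.lift (m b) with hΦd
  obtain ⟨κ, hκ⟩ := descQ X (fun b => Sigma.ι (fun b => (Q.obj (X b) : DerivedCategory (ModuleCat.{v} R))) b)
  let l : (∐ fun b => (Q.obj (X b) : DerivedCategory (ModuleCat.{v} R))) ⟶ Q.obj (∐ X) :=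
    Sigma.desc (fun b => Q.map (Sigma.ι X b))
  have hkl : κ ≫ l = 𝟙 _ := by
    rw [← sub_eq_zero]
    refine uniqQ X _ (fun b => ?_)
    rw [Preadditive.comp_sub, ← Category.assoc, hκ]
    simp [l]
  obtain ⟨t, ht⟩ := (hF B _ (hasCoprodQ X)).2 (x' ≫ inv (Q.map Φ) ≫ κ)
  obtain ⟨s, y, hy⟩ := comparison_sum F _ t
  rw [ht] at hy
  refine ⟨s, y, fun n => ?_⟩
  have h2 := congr($hy ≫ l ≫ Q.map Φ ≫ Q.map (Pi.π Y n))
  have h3 : (x' ≫ inv (Q.map Φ) ≫ κ) ≫ l ≫ Q.map Φ ≫ Q.map (Pi.π Y n) = x n := by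
    simp only [Category.assoc]
    rw [reassoc_of% hkl, IsIso.inv_hom_id_assoc, hx']
  rw [← h3, h2, Preadditive.sum_comp]
  refine Finset.sum_congr rfl (fun b _ => ?_)
  simp only [Category.assoc]
  simp only [l, Sigma.ι_desc_assoc]
  rw [← Q.map_comp, ← Q.map_comp]
  simp [Φ]
end
section
variable {R : Type} [Ring R]
open HomologicalComplex

abbrev Sg (R : Type) [Ring R] (n : ℤ) : Cx.{v} R :=
  (single (ModuleCat.{v} R) (ComplexShape.up ℤ) n).obj (RR R)

def gen0 (R : Type) [Ring R] (n : ℤ) : Zc (Sg.{v} R n) n :=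
  ⟨(singleObjXSelf (ComplexShape.up ℤ) n (RR R)).inv.hom (ULift.up.{v} (1 : R)), by
    rw [LinearMap.mem_ker, single_obj_d]; rfl⟩

lemma homotopy_of_zero {K : Cx.{v} R} (n : ℤ) (g : Sg.{v} R n ⟶ K)
    (h : (homologyMap g n).hom (cl _ n (gen0 R n)) = 0) : Nonempty (Homotopy g 0) := by
  rw [cl_map, cl_eq_zero_iff _ n (n-1) (by omega)] at h
  obtain ⟨y, hy⟩ := h
  let hh : ∀ i j, (ComplexShape.up ℤ).Rel j i → ((Sg.{v} R n).X i ⟶ K.X j) := fun i j r =>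
    if hi : i = n then
      (singleObjXIsoOfEq (ComplexShape.up ℤ) n (RR R) i hi).hom ≫
        tsp y ≫
          eqToHom (by
            have hr : j + 1 = i := r
            rw [show n - 1 = j by omega])
    else 0
  have : g = Homotopy.nullHomotopicMap' hh := by
    apply from_single_hom_ext
    rw [Homotopy.nullHomotopicMap'_f (k₂ := n-1) (k₁ := n) (k₀ := n+1) (by simp) (by simp)]
    rw [single_obj_d, zero_comp, zero_add]
    have h1 : hh n (n-1) (by simp) = (singleObjXSelf (ComplexShape.up ℤ) n (RR R)).hom ≫
        tsp y := by
      simp [hh, singleObjXSelf]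
    rw [h1, ← cancel_epi (singleObjXSelf (ComplexShape.up ℤ) n (RR R)).inv]
    simp only [Category.assoc, Iso.inv_hom_id_assoc]
    apply RR_ext
    rw [Zmap_val] at hy
    refine hy.symm.trans ?_
    change _ = (K.d (n-1) n).hom ((tsp y).hom _)
    rw [tsp_one]
  rw [this]
  exact ⟨Homotopy.nullHomotopy' hh⟩

lemma single_lift {K : Cx.{v} R} (n : ℤ) (v : K.homology n) :
    ∃ g : Sg.{v} R n ⟶ K, (homologyMap g n).hom (cl _ n (gen0 R n)) = v := by
  obtain ⟨z, rfl⟩ := cl_surj _ _ v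
  refine ⟨mkHomFromSingle (tsp z.1) ?_, ?_⟩
  · intro k hk
    simp at hk
    subst hk
    apply RR_ext
    change (K.d n (n+1)).hom ((tsp z.1).hom _) = 0
    rw [tsp_one]; exact z.2
  · rw [cl_map]
    congr 1
    ext
    rw [Zmap_val, mkHomFromSingle_f]
    refine (congrArg (tsp z.1).hom (iso_inv_hom
      (singleObjXSelf (ComplexShape.up ℤ) n (RR R)) (ULift.up.{v} (1 : R)))).trans ?_
    exact tsp_one z.1

variable [HasDerivedCategory.{w} (ModuleCat.{v} R)]

def u0 (R : Type) [Ring R] [HasDerivedCategory.{w} (ModuleCat.{v} R)] (n : ℤ) :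
    (HD.{w, v} R n).obj (Q.obj (Sg.{v} R n)) := (fac _ n).inv.hom (cl _ n (gen0 R n))

lemma HD_iso_inj {X Y : DerivedCategory (ModuleCat.{v} R)} (f : X ⟶ Y) [IsIso f] (n : ℤ) (x)
    (h : ((HD.{w, v} R n).map f).hom x = 0) : x = 0 := by
  have := congr(((HD.{w, v} R n).map (inv f)).hom $h)
  rw [← HD_comp, IsIso.hom_inv_id] at this
  simpa using this

lemma u0_inj (n : ℤ) {Y : DerivedCategory (ModuleCat.{v} R)} (f : Q.obj (Sg.{v} R n) ⟶ Y)
    (h : ((HD.{w, v} R n).map f).hom (u0 R n) = 0) : f = 0 := by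
  let e := Q.objObjPreimageIso Y
  obtain ⟨K, g, s, hs, hf⟩ := left_fac (f ≫ e.inv)
  have hg : f ≫ e.inv ≫ Q.map s = Q.map g := by
    rw [← Category.assoc, hf, Category.assoc, IsIso.inv_hom_id, Category.comp_id]
  have h1 : (homologyMap g n).hom (cl _ n (gen0 R n)) = 0 := by
    have : ((HD.{w, v} R n).map (Q.map g)).hom (u0 R n) = 0 := by
      rw [← hg, HD_comp, h, map_zero]
    rw [u0, fac_inv_nat] at this
    have := congr((fac K n).hom.hom $this)
    rwa [iso_inv_hom, map_zero] at this
  obtain ⟨H⟩ := homotopy_of_zero n g h1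
  have h0 : Q.map g = 0 := by
    rw [Q_map_eq_of_homotopy _ H, Functor.map_zero]
  rw [← cancel_mono (e.inv ≫ Q.map s), hg, h0, zero_comp]

lemma u0_surj (n : ℤ) {Y : DerivedCategory (ModuleCat.{v} R)} (v : (HD.{w, v} R n).obj Y) :
    ∃ f : Q.obj (Sg.{v} R n) ⟶ Y, ((HD.{w, v} R n).map f).hom (u0 R n) = v := by
  let e := Q.objObjPreimageIso Y
  obtain ⟨g, hg⟩ := single_lift n ((fac _ n).hom.hom (((HD.{w, v} R n).map e.inv).hom v))
  refine ⟨Q.map g ≫ e.hom, ?_⟩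
  rw [HD_comp, u0, fac_inv_nat, hg, iso_hom_inv, ← HD_comp, e.inv_hom_id]
  simp

lemma compact_Sg (n : ℤ) :
    IsCompactObject (Q.obj (Sg.{v} R n) : DerivedCategory (ModuleCat.{v} R)) := by
  classical
  intro ι f hf
  refine ⟨comparison_inj _ _, fun g => ?_⟩
  let X := fun i => Q.objPreimage (f i)
  let e := fun i => Q.objObjPreimageIso (f i)
  obtain ⟨θ, hθ⟩ := descQ X (fun i => (e i).hom ≫ Sigma.ι f i)
  let ρ : ∐ f ⟶ Q.obj (∐ X) := Sigma.desc (fun i => (e i).inv ≫ Q.map (Sigma.ι X i))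
  have hρ : ρ ≫ θ = 𝟙 _ := by
    refine Sigma.hom_ext _ _ (fun i => ?_)
    simp only [ρ, Sigma.ι_desc_assoc, Category.assoc, hθ]
    simp
  obtain ⟨s, y, hy⟩ := genQ X n (((HD.{w, v} R n).map (g ≫ ρ)).hom (u0 R n))
  choose t ht using fun i => u0_surj n (y i)
  have hg : g ≫ ρ = ∑ i ∈ s, t i ≫ Q.map (Sigma.ι X i) := by
    rw [← sub_eq_zero]
    apply u0_inj
    rw [Functor.map_sub, Functor.map_sum, ModuleCat.hom_sub, LinearMap.sub_apply, hy, sub_eq_zero,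
      ModuleCat.hom_sum, LinearMap.sum_apply]
    refine Finset.sum_congr rfl (fun i _ => ?_)
    rw [HD_comp, ht]
  refine ⟨∑ i ∈ s, DirectSum.of (fun i => _ ⟶ f i) i (t i ≫ (e i).hom), ?_⟩
  rw [map_sum]
  simp only [comparison_of]
  have : g = (g ≫ ρ) ≫ θ := by rw [Category.assoc, hρ, Category.comp_id]
  rw [this, hg, Preadditive.sum_comp]
  refine Finset.sum_congr rfl (fun i _ => ?_)
  simp only [Category.assoc, hθ]
end
section
variable {kk R : Type} [Field kk] [Ring R] [Algebra kk R]
open HomologicalComplex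

/-- The scalar endomorphism of a complex. -/
def scal (E : Cx.{v} R) (c : kk) : E ⟶ E := algebraMap kk (End E) c

lemma scal_f (E : Cx.{v} R) (c : kk) (n : ℤ) (x : E.X n) :
    ((scal E c).f n).hom x = algebraMap kk R c • x := by
  rfl

lemma scal_H (E : Cx.{v} R) (c : kk) (n : ℤ) (h : E.homology n) :
    (homologyMap (scal E c) n).hom h = algebraMap kk R c • h := by
  obtain ⟨z, rfl⟩ := cl_surj _ _ h
  rw [cl_map, ← map_smul]
  congr 1

lemma scal_shift (E : Cx.{v} R) (c : kk) (i : ℤ) :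
    (shiftFunctor (Cx.{v} R) i).map (scal E c) = scal ((shiftFunctor (Cx.{v} R) i).obj E) c := by
  ext n x
  rfl

lemma qi_crit {B N : Type} (X : B → Cx.{v} R) (Y : N → Cx.{v} R) (m : ∀ b n, X b ⟶ Y n)
    (hs : ∀ j (h : ∀ n, (Y n).homology j), ∃ (s : Finset B) (y : ∀ b, (X b).homology j),
      ∀ n, h n = ∑ b ∈ s, (homologyMap (m b n) j).hom (y b))
    (hi : ∀ j (s : Finset B) (y : ∀ b, (X b).homology j),
      (∀ n, ∑ b ∈ s, (homologyMap (m b n) j).hom (y b) = 0) → ∀ b ∈ s, y b = 0) :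
    QuasiIso (Sigma.desc fun b => Pi.lift (m b)) := by
  have key : ∀ j (s : Finset B) (y : ∀ b, (X b).homology j) n,
      (homologyMap (Pi.π Y n) j).hom ((homologyMap (Sigma.desc fun b => Pi.lift (m b)) j).hom
        (∑ b ∈ s, (homologyMap (Sigma.ι X b) j).hom (y b))) =
      ∑ b ∈ s, (homologyMap (m b n) j).hom (y b) := by
    intro j s y n
    rw [map_sum, map_sum]
    refine Finset.sum_congr rfl (fun b _ => ?_)
    rw [← hMap_comp, ← hMap_comp, Sigma.ι_desc_assoc, Pi.lift_π]
  apply quasiIso_of_bij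
  intro j
  constructor
  · rw [injective_iff_map_eq_zero]
    intro h h0
    obtain ⟨s, y, rfl⟩ := gen_H X j h
    refine Finset.sum_eq_zero (fun b hb => ?_)
    rw [hi j s y (fun n => by rw [← key, h0, map_zero]) b hb, map_zero]
  · intro h
    obtain ⟨s, y, hy⟩ := hs j (fun n => (homologyMap (Pi.π Y n) j).hom h)
    refine ⟨∑ b ∈ s, (homologyMap (Sigma.ι X b) j).hom (y b), ?_⟩
    rw [← sub_eq_zero]
    refine pi_H_ext Y j _ (fun n => ?_)
    rw [map_sub, key, ← hy, sub_self]

lemma la_surj {V : Type v} [AddCommGroup V] [Module kk V] [Module.Finite kk V] {ι : Type}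
    (β : Module.Basis ι kk (ℕ → kk)) (h : ℕ → V) :
    ∃ (s : Finset ι) (y : ι → V), ∀ n, h n = ∑ b ∈ s, β b n • y b := by
  classical
  let v := Module.finBasis kk V
  let c : Fin (Module.finrank kk V) → ℕ → kk := fun l n => v.repr (h n) l
  refine ⟨Finset.univ.biUnion (fun l => (β.repr (c l)).support),
    fun b => ∑ l, (β.repr (c l) b) • v l, fun n => ?_⟩
  have hc : ∀ l, c l n = ∑ b ∈ Finset.univ.biUnion (fun l => (β.repr (c l)).support),
      β.repr (c l) b * β b n := by
    intro l
    have h1 := β.linearCombination_repr (c l)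
    rw [Finsupp.linearCombination_apply, Finsupp.sum] at h1
    conv_lhs => rw [← h1]
    rw [Finset.sum_apply]
    simp only [Pi.smul_apply, smul_eq_mul]
    refine Finset.sum_subset (Finset.subset_biUnion_of_mem (fun l => (β.repr (c l)).support)
      (Finset.mem_univ l)) (fun b _ hb => ?_)
    rw [Finsupp.notMem_support_iff.1 hb, zero_mul]
  conv_lhs => rw [← v.sum_repr (h n)]
  simp only [Finset.smul_sum]
  rw [Finset.sum_comm]
  refine Finset.sum_congr rfl (fun l _ => ?_)
  change c l n • v l = _
  rw [hc, Finset.sum_smul]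
  refine Finset.sum_congr rfl (fun b _ => ?_)
  rw [smul_smul, mul_comm]

lemma la_inj {V : Type v} [AddCommGroup V] [Module kk V] [Module.Finite kk V] {ι : Type}
    (β : Module.Basis ι kk (ℕ → kk)) (s : Finset ι) (y : ι → V)
    (h : ∀ n, ∑ b ∈ s, β b n • y b = 0) : ∀ b ∈ s, y b = 0 := by
  intro b hb
  let v := Module.finBasis kk V
  apply v.repr.injective
  ext l
  rw [map_zero]
  refine linearIndependent_iff'.1 β.linearIndependent s (fun b => v.repr (y b) l) ?_ b hb
  ext n
  have := congr(v.repr $(h n) l)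
  simp only [map_sum, map_smul, Finsupp.coe_finsetSum, Finset.sum_apply, Finsupp.smul_apply,
    smul_eq_mul, map_zero, Finsupp.coe_zero, Pi.zero_apply] at this
  rw [Finset.sum_apply]
  simp only [Pi.smul_apply, smul_eq_mul, Pi.zero_apply]
  rw [← this]
  exact Finset.sum_congr rfl (fun b _ => mul_comm _ _)

lemma qi_scal (L : Cx.{v} R) (hL : ∀ j, FiniteDimensional kk
      ((ModuleCat.restrictScalars (algebraMap kk R)).obj (L.homology j)))
    {ι : Type} (β : Module.Basis ι kk (ℕ → kk)) :
    QuasiIso (Sigma.desc fun b : ι => Pi.lift fun n : ℕ => scal L (β b n)) := by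
  refine qi_crit (fun _ : ι => L) (fun _ : ℕ => L) (fun b n => scal L (β b n)) ?_ ?_
  · intro j h
    have := hL j
    obtain ⟨s, y, hy⟩ := la_surj
      (V := ((ModuleCat.restrictScalars (algebraMap kk R)).obj (L.homology j))) β h
    refine ⟨s, y, fun n => ?_⟩
    exact (hy n).trans (Finset.sum_congr rfl fun b _ => (scal_H L (β b n) j (y b)).symm)
  · intro j s y h
    have := hL j
    simp only [scal_H] at h
    exact la_inj (V := ((ModuleCat.restrictScalars (algebraMap kk R)).obj (L.homology j))) β s y h

lemma homModule_smul {D : Type*} [Category D] [Preadditive D]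
    {G : D} (φ : kk →+* End G) (F : D) (c : kk) (f : F ⟶ G) :
    (letI := homModule φ F; c • f) = f ≫ (φ c : G ⟶ G) := rfl

variable [HasDerivedCategory.{w} (ModuleCat.{v} R)]

def eSh (E : Cx.{v} R) (i : ℤ) : (Q.obj ((shiftFunctor (Cx.{v} R) i).obj E) : DerivedCategory (ModuleCat.{v} R)) ≅
    (shiftFunctor (DerivedCategory (ModuleCat.{v} R)) i).obj (Q.obj E) :=
  (Q.commShiftIso i).app E

lemma eSh_nat (E : Cx.{v} R) (i : ℤ) (c : kk) :
    Q.map (scal ((shiftFunctor (Cx.{v} R) i).obj E) c) ≫ (eSh E i).hom =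
      (eSh E i).hom ≫ (shiftedScalarAction kk R E i c :
        (shiftFunctor (DerivedCategory (ModuleCat.{v} R)) i).obj (Q.obj E) ⟶ _) := by
  rw [← scal_shift]
  exact (Q.commShiftIso i).hom.naturality (scal E c)

lemma homRank_finite {F : DerivedCategory (ModuleCat.{v} R)} (hF : IsCompactObject F) (E : Cx.{v} R)
    (hE : ∀ j, FiniteDimensional kk
      ((ModuleCat.restrictScalars (algebraMap kk R)).obj (E.homology j))) (i : ℤ) :
    homRank kk (shiftedScalarAction kk R E i) F < Cardinal.aleph0 := by
  letI := homModule (shiftedScalarAction kk R E i) F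
  change Module.rank kk (F ⟶ (shiftFunctor (DerivedCategory (ModuleCat.{v} R)) i).obj (Q.obj E)) < _
  rw [Module.rank_lt_aleph0_iff]
  by_contra hinf
  let bb := Module.Basis.ofVectorSpace kk (F ⟶ (shiftFunctor (DerivedCategory (ModuleCat.{v} R)) i).obj (Q.obj E))
  have hI : Infinite (Module.Basis.ofVectorSpaceIndex kk
      (F ⟶ (shiftFunctor (DerivedCategory (ModuleCat.{v} R)) i).obj (Q.obj E))) := by
    by_contra hI
    rw [not_infinite_iff_finite] at hI
    exact hinf (Module.Finite.of_basis bb)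
  let a := Infinite.natEmbedding (Module.Basis.ofVectorSpaceIndex kk
      (F ⟶ (shiftFunctor (DerivedCategory (ModuleCat.{v} R)) i).obj (Q.obj E)))
  have hli : LinearIndependent kk (fun n => bb (a n)) :=
    bb.linearIndependent.comp a a.injective
  let β := Module.Basis.ofVectorSpace kk (ℕ → kk)
  have hL : ∀ j, FiniteDimensional kk ((ModuleCat.restrictScalars (algebraMap kk R)).obj
      (((shiftFunctor (Cx.{v} R) i).obj E).homology j)) := by
    intro j
    have := hE (i + j)
    let e : ((shiftFunctor (Cx.{v} R) i).obj E).homology j ≅ E.homology (i+j) :=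
      (CochainComplex.ShiftSequence.shiftIso (ModuleCat.{v} R) i j (i+j) rfl).app E
    exact Module.Finite.equiv ((ModuleCat.restrictScalars (algebraMap kk R)).mapIso e).symm.toLinearEquiv
  obtain ⟨s, y, hy⟩ := main_lift hF _ _ _ (qi_scal _ hL β) (fun n => bb (a n) ≫ (eSh E i).inv)
  have hmem : ∀ n, bb (a n) ∈ Submodule.span kk (Set.range fun b : s => y b ≫ (eSh E i).hom) := by
    intro n
    have h1 : bb (a n) = ∑ b ∈ s, (β b n) • (y b ≫ (eSh E i).hom) := by
      have := congr($(hy n) ≫ (eSh E i).hom)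
      rw [Category.assoc, Iso.inv_hom_id, Category.comp_id, Preadditive.sum_comp] at this
      rw [this]
      refine Finset.sum_congr rfl (fun b _ => ?_)
      rw [Category.assoc, eSh_nat, ← Category.assoc]
      rfl
    rw [h1]
    refine Submodule.sum_mem _ (fun b hb => Submodule.smul_mem _ _ (Submodule.subset_span ⟨⟨b, hb⟩, rfl⟩))
  let W := Submodule.span kk (Set.range fun b : s => y b ≫ (eSh E i).hom)
  have : Module.Finite kk W := Module.Finite.span_of_finite kk (Set.finite_range _)
  have hli' : LinearIndependent kk (fun n => (⟨bb (a n), hmem n⟩ : W)) :=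
    LinearIndependent.of_comp W.subtype hli
  have := hli'.finite
  exact not_finite ℕ

open Classical in
lemma hom_finite_support {F : DerivedCategory (ModuleCat.{v} R)} (hF : IsCompactObject F) (E : Cx.{v} R)
    (p q : ℤ) (hE : ∀ j, (j < p ∨ q < j) → ∀ x : E.homology j, x = 0) :
    {i : ℤ | ∃ f : F ⟶ (shiftFunctor (DerivedCategory (ModuleCat.{v} R)) i).obj (Q.obj E), f ≠ 0}.Finite := by
  by_contra hinf
  have hI := Set.infinite_coe_iff.2 hinf
  haveI := hI
  let a := Infinite.natEmbedding {i : ℤ | ∃ f : F ⟶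
    (shiftFunctor (DerivedCategory (ModuleCat.{v} R)) i).obj (Q.obj E), f ≠ 0}
  choose x hx using fun n => (a n).2
  let X : ℕ → Cx.{v} R := fun n => (shiftFunctor (Cx.{v} R) (a n).1).obj E
  let m : ∀ b n, X b ⟶ X n := fun b n => if h : b = n then eqToHom (by rw [h]) else 0
  have hself : ∀ n, m n n = 𝟙 _ := fun n => by simp [m]
  have hne : ∀ b n, b ≠ n → m b n = 0 := fun b n h => by simp [m, h]
  have hfin : ∀ j, {n | ¬ ∀ x : (X n).homology j, x = 0}.Finite := by
    intro j
    have h1 : ((fun n => (a n).1) ⁻¹' (Set.Icc (p - j) (q - j))).Finite :=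
      (Set.finite_Icc _ _).preimage
        ((Subtype.val_injective.comp a.injective).injOn)
    refine h1.subset (fun n hn => ?_)
    by_contra hn'
    apply hn
    let e : (X n).homology j ≅ E.homology ((a n).1+j) :=
      (CochainComplex.ShiftSequence.shiftIso (ModuleCat.{v} R) (a n).1 j ((a n).1+j) rfl).app E
    intro x
    rw [← iso_hom_inv e x, hE _ _ (e.hom.hom x), map_zero]
    simp only [Set.mem_preimage, Set.mem_Icc, not_and_or, not_le] at hn'
    omega
  have hsum : ∀ j (s : Finset ℕ) (y : ∀ b, (X b).homology j), ∀ n ∈ s,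
      ∑ b ∈ s, (homologyMap (m b n) j).hom (y b) = y n := by
    intro j s y n hn
    rw [Finset.sum_eq_single n]
    · rw [hself]; simp
    · intro b _ hb; rw [hne b n hb]; simp
    · intro h; exact absurd hn h
  have hQ : QuasiIso (Sigma.desc fun b => Pi.lift (m b)) := by
    refine qi_crit X X m ?_ ?_
    · intro j h
      refine ⟨(hfin j).toFinset, h, fun n => ?_⟩
      by_cases hn : n ∈ (hfin j).toFinset
      · rw [hsum j _ h n hn]
      · have hn0 : ∀ x : (X n).homology j, x = 0 := by simpa using hn
        rw [hn0 (h n), hn0 (∑ b ∈ _, _)]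
    · intro j s y h b hb
      rw [← hsum j s y b hb, h]
  obtain ⟨s, y, hy⟩ := main_lift hF X X m hQ (fun n => x n ≫ (eSh E (a n).1).inv)
  obtain ⟨n, hn⟩ := Infinite.exists_notMem_finset s
  apply hx n
  rw [← cancel_mono (eSh E (a n).1).inv, zero_comp, hy n]
  refine Finset.sum_eq_zero (fun b hb => ?_)
  rw [hne b n (fun h => hn (h ▸ hb)), Functor.map_zero, comp_zero]

lemma forward_dir (E : Cx.{v} R) (i : ℤ)
    (h : homRank kk (shiftedScalarAction kk R E 0) (Q.obj (Sg.{v} R i)) < Cardinal.aleph0) :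
    FiniteDimensional kk ((ModuleCat.restrictScalars (algebraMap kk R)).obj (E.homology i)) := by
  letI := homModule (shiftedScalarAction kk R E 0) (Q.obj (Sg.{v} R i))
  let G := (shiftFunctor (DerivedCategory (ModuleCat.{v} R)) (0 : ℤ)).obj (Q.obj E)
  change Module.rank kk (Q.obj (Sg.{v} R i) ⟶ G) < _ at h
  rw [Module.rank_lt_aleph0_iff] at h
  let z : G ≅ Q.obj E := (shiftFunctorZero (DerivedCategory (ModuleCat.{v} R)) ℤ).app (Q.obj E)
  let T : (Q.obj (Sg.{v} R i) ⟶ G) →ₗ[kk]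
      ((ModuleCat.restrictScalars (algebraMap kk R)).obj (E.homology i)) :=
    { toFun := fun f => (fac E i).hom.hom (((HD.{w, v} R i).map (f ≫ z.hom)).hom (u0 R i))
      map_add' := fun f g => by
        rw [Preadditive.add_comp, Functor.map_add, ModuleCat.hom_add, LinearMap.add_apply]
        exact map_add (fac E i).hom.hom _ _
      map_smul' := fun c f => by
        have h1 : (c • f) ≫ z.hom = (f ≫ z.hom) ≫ Q.map (scal E c) := by
          rw [Category.assoc]
          refine Eq.trans (Category.assoc _ _ _) ?_
          congr 1
          exact (shiftFunctorZero (DerivedCategory (ModuleCat.{v} R)) ℤ).hom.naturality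
            (Q.map (scal E c))
        rw [h1, HD_comp, fac_hom_nat, scal_H]
        rfl }
  refine Module.Finite.of_surjective T (fun v => ?_)
  obtain ⟨f, hf⟩ := u0_surj i ((fac E i).inv.hom v)
  refine ⟨f ≫ z.inv, ?_⟩
  change (fac E i).hom.hom (((HD.{w, v} R i).map ((f ≫ z.inv) ≫ z.hom)).hom (u0 R i)) = v
  rw [Category.assoc, Iso.inv_hom_id, Category.comp_id, hf]
  exact iso_inv_hom (fac E i) v

lemma perfect_bounded (E : Cx.{v} R) (hE : IsPerfectComplex R E) :
    ∃ p q : ℤ, ∀ j, (j < p ∨ q < j) → ∀ x : E.homology j, x = 0 := by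
  obtain ⟨P, ⟨p, q, hP⟩, -, ⟨e⟩⟩ := hE
  refine ⟨p, q, fun j hj x => ?_⟩
  let e' : P.homology j ≅ E.homology j := (fac P j).symm ≪≫ (HD.{w, v} R j).mapIso e ≪≫ fac E j
  rw [← iso_inv_hom e' x]
  suffices e'.inv.hom x = 0 by rw [this, map_zero]
  obtain ⟨⟨z, hz⟩, h⟩ := cl_surj P j (e'.inv.hom x)
  rw [← h]
  have : Subsingleton (P.X j) := ModuleCat.subsingleton_of_isZero (hP j hj)
  have h0 : (⟨z, hz⟩ : Zc P j) = 0 := Subtype.ext (Subsingleton.elim _ _)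
  rw [h0, map_zero]

lemma sum_lt_of_finite (f : ℤ → Cardinal.{w}) (h1 : ∀ i, f i < Cardinal.aleph0)
    (h2 : {i | f i ≠ 0}.Finite) : Cardinal.sum f < Cardinal.aleph0 := by
  have : ∀ i, Finite (f i).out := fun i => by
    rw [← Cardinal.lt_aleph0_iff_finite, Cardinal.mk_out]; exact h1 i
  have := h2.to_subtype
  have hfin : Finite (Σ i : ℤ, (f i).out) := by
    refine Finite.of_injective (β := Σ i : {i | f i ≠ 0}, (f i.1).out)
      (fun t => ⟨⟨t.1, fun h0 => ?_⟩, t.2⟩) ?_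
    · have := t.2
      rw [h0] at this
      have h3 := Cardinal.mk_out (0 : Cardinal.{w})
      rw [Cardinal.mk_eq_zero_iff] at h3
      exact h3.false this
    · rintro ⟨i, x⟩ ⟨j, y⟩ h
      simp only [Sigma.mk.injEq, Subtype.mk.injEq] at h
      obtain ⟨rfl, h⟩ := h
      simpa using h
  exact Cardinal.lt_aleph0_iff_finite.2 hfin
end
/-!
STATEMENT 9: Let `A` be an algebra over a field `k`. A perfect complex `E` of left
`A`-modules is compactly supported in `D(A-Mod)` (that is, for every compact object `F`
of `D(A-Mod)`, `∑ i : ℤ, dim_k Hom_{D(A-Mod)}(F, E[i])` is finite) if and only if every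
cohomology module `Hⁱ(E)` is finite-dimensional over `k`.
-/
theorem perfect_compactly_supported_iff_finite_dimensional_cohomology
    (E : CochainComplex (ModuleCat A) ℤ) (hE : IsPerfectComplex A E) :
    (∀ F : DerivedCategory (ModuleCat A), IsCompactObject F →
      (Cardinal.sum fun i : ℤ =>
        homRank k (shiftedScalarAction k A E i) F) < Cardinal.aleph0) ↔
    (∀ i : ℤ, FiniteDimensional k
      ((ModuleCat.restrictScalars (algebraMap k A)).obj (E.homology i))) := by
  constructor
  · intro h i
    refine forward_dir E i (lt_of_le_of_lt ?_ (h _ (compact_Sg i)))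
    have := Cardinal.le_sum (fun i' : ℤ => homRank k (shiftedScalarAction k A E i')
      (Q.obj (Sg A i))) 0
    simpa using this
  · intro h F hF
    obtain ⟨p, q, hpq⟩ := perfect_bounded E hE
    refine sum_lt_of_finite _ (homRank_finite hF E h) ((hom_finite_support hF E p q hpq).subset ?_)
    intro i hi
    by_contra hn
    apply hi
    simp only [Set.mem_setOf_eq, not_exists, not_not] at hn
    letI := homModule (shiftedScalarAction k A E i) F
    have : Subsingleton (F ⟶ (shiftFunctor (DerivedCategory (ModuleCat A)) i).obj (Q.obj E)) :=
      ⟨fun f g => by rw [hn f, hn g]⟩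
    change Module.rank k (F ⟶ (shiftFunctor (DerivedCategory (ModuleCat A)) i).obj (Q.obj E)) = 0
    exact rank_subsingleton' k _


end
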